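/- Let J ⊆ A(𝔹_d) be a closed ideal and let E ⊆ 𝕊_d be an A(𝔹_d)-totally null Borel set such that the closure of E is contained in Z(J) ∪ E. Let J' = J ∩ I(E). Then Z(J') = Z(J) ∪ E. -/

import Mathlib

open MeasureTheory Metric Set Filter Topology

noncomputable section

abbrev CB (d : ℕ) : Set (EuclideanSpace ℂ (Fin d)) := Metric.closedBall 0 1

instance (d : ℕ) : CompactSpace (CB d) :=
  isCompact_iff_compactSpace.mp (isCompact_closedBall _ _)

instance (d : ℕ) : MeasurableSpace (EuclideanSpace ℂ (Fin d)) := borel _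

instance (d : ℕ) : BorelSpace (EuclideanSpace ℂ (Fin d)) := ⟨rfl⟩

def polyAlg (d : ℕ) : Subalgebra ℂ C(CB d, ℂ) :=
  Algebra.adjoin ℂ
    { f : C(CB d, ℂ) | ∃ i : Fin d,
        f = ⟨fun z => (z : EuclideanSpace ℂ (Fin d)) i,
             (EuclideanSpace.proj (𝕜 := ℂ) i).continuous.comp continuous_subtype_val⟩ }

def ballAlgSub (d : ℕ) : Subalgebra ℂ C(CB d, ℂ) := (polyAlg d).topologicalClosure

def ballAlg (d : ℕ) : Set C(CB d, ℂ) := ballAlgSub d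

def sphereD (d : ℕ) : Set (CB d) := {z | ‖(z : EuclideanSpace ℂ (Fin d))‖ = 1}

def openD (d : ℕ) : Set (CB d) := {z | ‖(z : EuclideanSpace ℂ (Fin d))‖ < 1}

def ZS (d : ℕ) (S : Set C(CB d, ℂ)) : Set (CB d) := {z | ∀ φ ∈ S, φ z = 0}

def IX (d : ℕ) (X : Set (CB d)) : Set C(CB d, ℂ) :=
  {φ | φ ∈ ballAlg d ∧ ∀ z ∈ X, φ z = 0}

def IsZeroSet (d : ℕ) (X : Set (CB d)) : Prop :=
  ∃ S ⊆ ballAlg d, X = ZS d S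

/-- A representing measure for a point of the closed ball: a finite positive regular
Borel measure integrating every function of the ball algebra to its value at the point. -/
def IsRepMeasure (d : ℕ) (lam : CB d) (μ : Measure (CB d)) : Prop :=
  IsFiniteMeasure μ ∧ μ.Regular ∧ ∀ φ ∈ ballAlg d, φ lam = ∫ z, φ z ∂μ

/-- `X̂₀` : `X₀` together with all points of the open ball having a representing measure
supported on `X₀`. -/
def hatSet (d : ℕ) (X0 : Set (CB d)) : Set (CB d) :=
  X0 ∪ {lam | lam ∈ openD d ∧
    ∃ μ : Measure (CB d), IsRepMeasure d lam μ ∧ μ X0ᶜ = 0}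

/-- `z` is an isolated point of the set `A`. -/
def IsIsolatedIn (d : ℕ) (A : Set (CB d)) (z : CB d) : Prop :=
  z ∈ A ∧ ∃ U : Set (CB d), IsOpen U ∧ U ∩ A = {z}

/-- A closed ideal of the ball algebra. -/
structure IsClosedIdeal (d : ℕ) (J : Set C(CB d, ℂ)) : Prop where
  subset : J ⊆ ballAlg d
  closed : IsClosed J
  zero_mem : (0 : C(CB d, ℂ)) ∈ J
  add_mem : ∀ f ∈ J, ∀ g ∈ J, f + g ∈ J
  smul_mem : ∀ (c : ℂ), ∀ f ∈ J, c • f ∈ J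
  mul_mem : ∀ f ∈ ballAlg d, ∀ g ∈ J, f * g ∈ J

/-- An `A(𝔹_d)`-Henkin (finite positive regular Borel) measure on the sphere. -/
def IsHenkin (d : ℕ) (μ : Measure (CB d)) : Prop :=
  IsFiniteMeasure μ ∧ μ.Regular ∧ μ (sphereD d)ᶜ = 0 ∧
    ∀ f : ℕ → C(CB d, ℂ), (∀ n, f n ∈ ballAlg d) → (∃ C : ℝ, ∀ n, ‖f n‖ ≤ C) →
      (∀ z ∈ openD d, Tendsto (fun n => f n z) atTop (𝓝 0)) →
      Tendsto (fun n => ∫ z, f n z ∂μ) atTop (𝓝 0)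

/-- An `A(𝔹_d)`-totally null subset of the sphere. -/
def IsTotallyNull (d : ℕ) (K : Set (CB d)) : Prop :=
  K ⊆ sphereD d ∧ ∀ μ : Measure (CB d), IsHenkin d μ → μ K = 0

/-- A complex regular Borel measure on the sphere, given by its polar decomposition:
total variation `var` (a finite positive regular Borel measure concentrated on the
sphere) and a unimodular density. -/
structure CMeasure (d : ℕ) where
  var : Measure (CB d)
  density : CB d → ℂ
  finite : IsFiniteMeasure var
  regular : var.Regular
  measurable_density : Measurable density
  norm_density : ∀ z, ‖density z‖ = 1
  onSphere : var (sphereD d)ᶜ = 0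

/-- Integral of a continuous function against a complex measure. -/
def cInt (d : ℕ) (μ : CMeasure d) (φ : C(CB d, ℂ)) : ℂ :=
  ∫ z, φ z * μ.density z ∂μ.var

/-- An `A(𝔹_d)`-Henkin complex measure on the sphere. -/
def IsHenkinC (d : ℕ) (μ : CMeasure d) : Prop :=
  ∀ f : ℕ → C(CB d, ℂ), (∀ n, f n ∈ ballAlg d) → (∃ C : ℝ, ∀ n, ‖f n‖ ≤ C) →
    (∀ z ∈ openD d, Tendsto (fun n => f n z) atTop (𝓝 0)) →
    Tendsto (fun n => cInt d μ (f n)) atTop (𝓝 0)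

/-- An `A(𝔹_d)`-totally singular complex measure: its total variation is mutually
singular with that of every Henkin complex measure. -/
def IsTotallySingularC (d : ℕ) (μ : CMeasure d) : Prop :=
  ∀ ν : CMeasure d, IsHenkinC d ν → μ.var ⟂ₘ ν.var

/-- An `A(𝔹_d)`-totally null Borel subset of the sphere (complex-measure version). -/
def IsTotallyNullC (d : ℕ) (K : Set (CB d)) : Prop :=
  K ⊆ sphereD d ∧ ∀ μ : CMeasure d, IsHenkinC d μ → μ.var K = 0


/-- The value at a vector of a polynomial in the coordinates. -/
def polyVal {d : ℕ} (p : MvPolynomial (Fin d) ℂ) (x : EuclideanSpace ℂ (Fin d)) : ℂ :=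
  MvPolynomial.eval (fun i => x i) p

/-- The derivative of a polynomial at `x` in the direction `v`. -/
def dirDeriv {d : ℕ} (p : MvPolynomial (Fin d) ℂ) (x v : EuclideanSpace ℂ (Fin d)) : ℂ :=
  ∑ i, v i * polyVal (MvPolynomial.pderiv i p) x

lemma hasDerivAt_polyVal_line {d : ℕ} (p : MvPolynomial (Fin d) ℂ)
    (x v : EuclideanSpace ℂ (Fin d)) (t : ℂ) :
    HasDerivAt (fun s : ℂ => polyVal p (x + s • v)) (dirDeriv p (x + t • v) v) t := by
  induction p using MvPolynomial.induction_on with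
  | C a => simpa [polyVal, dirDeriv] using hasDerivAt_const t a
  | add p q hp hq =>
    refine ((hp.add hq).congr_of_eventuallyEq (.of_forall fun s => ?_)).congr_deriv ?_
    · simp [polyVal]
    · simp [dirDeriv, polyVal, mul_add, Finset.sum_add_distrib]
  | mul_X p i hp =>
    have h1 : HasDerivAt (fun s : ℂ => x i + s * v i) (v i) t := by
      simpa using ((hasDerivAt_id t).mul_const (v i)).const_add (x i)
    refine ((hp.mul h1).congr_of_eventuallyEq (.of_forall fun s => ?_)).congr_deriv ?_
    · simp [polyVal]
    · simp only [dirDeriv, polyVal, Derivation.leibniz, MvPolynomial.pderiv_X, map_add, smul_eq_mul,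
        map_mul, MvPolynomial.eval_X, mul_add, Finset.sum_add_distrib, Finset.sum_mul]
      rw [add_comm]
      congr 1
      rotate_left
      · rw [← Finset.sum_add_distrib]
        exact Finset.sum_congr rfl fun j _ => by simp; ring
      · rw [Finset.sum_eq_single i]
        · simp [mul_comm]
        · intro j _ hj
          simp [hj.symm]
        · simp

lemma norm_dirDeriv_le {d : ℕ} (p : MvPolynomial (Fin d) ℂ) (x v : EuclideanSpace ℂ (Fin d))
    {ρ M : ℝ} (hρ : 0 < ρ) (hM : ∀ s : ℂ, ‖s‖ = ρ → ‖polyVal p (x + s • v)‖ ≤ M) :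
    ‖dirDeriv p x v‖ ≤ M / ρ := by
  have h := Complex.norm_deriv_le_of_forall_mem_sphere_norm_le (c := 0) (C := M)
    (f := fun s : ℂ => polyVal p (x + s • v)) hρ
    (Differentiable.diffContOnCl fun s => (hasDerivAt_polyVal_line p x v s).differentiableAt)
    (fun s hs => hM s (by simpa using hs))
  rw [(hasDerivAt_polyVal_line p x v 0).deriv] at h
  simpa using h

lemma exists_radial_primitive {d : ℕ} (Q : MvPolynomial (Fin d) ℂ) :
    ∃ G : MvPolynomial (Fin d) ℂ, ∀ (x : EuclideanSpace ℂ (Fin d)) (t : ℂ),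
      HasDerivAt (fun s : ℂ => s * polyVal G (s • x)) (polyVal Q (t • x)) t := by
  induction Q using MvPolynomial.induction_on' with
  | add p q hp hq =>
    obtain ⟨G, hG⟩ := hp
    obtain ⟨H, hH⟩ := hq
    refine ⟨G + H, fun x t => (((hG x t).add (hH x t)).congr_of_eventuallyEq
      (.of_forall fun s => ?_)).congr_deriv ?_⟩ <;> simp [polyVal, mul_add]
  | monomial m a =>
    refine ⟨MvPolynomial.monomial m (a / ((∑ i ∈ m.support, m i : ℕ) + 1)), fun x t => ?_⟩
    have hmon : ∀ (b s : ℂ), polyVal (MvPolynomial.monomial m b) (s • x) =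
        b * s ^ (∑ i ∈ m.support, m i) * ∏ i ∈ m.support, x i ^ m i := by
      intro b s
      simp [polyVal, MvPolynomial.eval_monomial, Finsupp.prod, mul_pow, Finset.prod_mul_distrib,
        Finset.prod_pow_eq_pow_sum, mul_assoc]
    have hn : ((∑ i ∈ m.support, m i : ℕ) : ℂ) + 1 ≠ 0 := Nat.cast_add_one_ne_zero _
    simp only [hmon]
    refine ((((hasDerivAt_pow ((∑ i ∈ m.support, m i) + 1) t).const_mul
      (a / ((∑ i ∈ m.support, m i : ℕ) + 1))).mul_const (∏ i ∈ m.support, x i ^ m i)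
      ).congr_of_eventuallyEq (.of_forall fun s => ?_)).congr_deriv ?_
    · ring
    · rw [Nat.cast_add, Nat.cast_one, Nat.add_sub_cancel]
      generalize ∑ i ∈ m.support, m i = n at hn ⊢
      field_simp

lemma dirDeriv_single {d : ℕ} (p : MvPolynomial (Fin d) ℂ) (x : EuclideanSpace ℂ (Fin d))
    (j : Fin d) : dirDeriv p x (EuclideanSpace.single j 1) = polyVal (MvPolynomial.pderiv j p) x := by
  rw [dirDeriv, Finset.sum_eq_single j] <;> simp +contextual

lemma dirDeriv_sub_smul {d : ℕ} (p : MvPolynomial (Fin d) ℂ) (x v w : EuclideanSpace ℂ (Fin d))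
    (a b : ℂ) : dirDeriv p x (a • v - b • w) = a * dirDeriv p x v - b * dirDeriv p x w := by
  simp only [dirDeriv, Finset.mul_sum, ← Finset.sum_sub_distrib]
  exact Finset.sum_congr rfl fun i _ => by simp; ring

/-- The component of the `j`-th coordinate vector orthogonal to `x`, scaled by `‖x‖ ^ 2`. -/
def tangentVec {d : ℕ} (j : Fin d) (x : EuclideanSpace ℂ (Fin d)) : EuclideanSpace ℂ (Fin d) :=
  ((‖x‖ ^ 2 : ℝ) : ℂ) • EuclideanSpace.single j (1 : ℂ) - (starRingEnd ℂ (x j)) • x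

lemma inner_tangentVec {d : ℕ} (j : Fin d) (x : EuclideanSpace ℂ (Fin d)) :
    inner ℂ x (tangentVec j x) = 0 := by
  rw [tangentVec, inner_sub_right, inner_smul_right, inner_smul_right, inner_self_eq_norm_sq_to_K,
    EuclideanSpace.inner_single_right]
  push_cast
  simp
  ring

lemma norm_tangentVec_le {d : ℕ} (j : Fin d) {x : EuclideanSpace ℂ (Fin d)} (hx : ‖x‖ ≤ 1) :
    ‖tangentVec j x‖ ≤ 1 := by
  have h := norm_add_sq_eq_norm_sq_add_norm_sq_of_inner_eq_zero (𝕜 := ℂ) (tangentVec j x)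
    ((starRingEnd ℂ (x j)) • x)
    (by rw [inner_smul_right, ← inner_conj_symm, inner_tangentVec]; simp)
  have h2 : tangentVec j x + (starRingEnd ℂ (x j)) • x =
      ((‖x‖ ^ 2 : ℝ) : ℂ) • EuclideanSpace.single j (1 : ℂ) := by simp [tangentVec]
  rw [h2] at h
  have h3 : ‖((‖x‖ ^ 2 : ℝ) : ℂ) • EuclideanSpace.single j (1 : ℂ)‖ = ‖x‖ ^ 2 := by
    rw [norm_smul]; simp
  rw [h3] at h
  have h4 : ‖x‖ ^ 2 ≤ 1 := pow_le_one₀ (norm_nonneg _) hx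
  nlinarith [norm_nonneg (tangentVec j x), norm_nonneg ((starRingEnd ℂ (x j)) • x),
    sq_nonneg ‖x‖]

lemma norm_smul_add_smul_tangentVec_le {d : ℕ} (j : Fin d) {x : EuclideanSpace ℂ (Fin d)}
    (hx : ‖x‖ ≤ 1) (t s : ℂ) :
    ‖t • x + s • tangentVec j x‖ ^ 2 ≤ ‖t‖ ^ 2 + ‖s‖ ^ 2 := by
  have h := norm_add_sq_eq_norm_sq_add_norm_sq_of_inner_eq_zero (𝕜 := ℂ) (t • x)
    (s • tangentVec j x)
    (by rw [inner_smul_right, inner_smul_left, inner_tangentVec]; simp)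
  rw [norm_smul, norm_smul] at h
  have h1 := mul_le_of_le_one_right (norm_nonneg t) hx
  have h2 := mul_le_of_le_one_right (norm_nonneg s) (norm_tangentVec_le j hx)
  have h3 := mul_nonneg (norm_nonneg t) (norm_nonneg x)
  have h4 := mul_nonneg (norm_nonneg s) (norm_nonneg (tangentVec j x))
  nlinarith

/-- The function `G = ∫₀¹ (∂p/∂z_j)(t z) dt` replaces `conj z_j * p`: it is controlled by `p` on
smaller balls and `‖z‖² G - conj z_j p` is controlled by `p` on a smaller ball up to a small
multiple of the sup norm of `p`. -/
lemma exists_conj_mul_approx_aux {d : ℕ} (p : MvPolynomial (Fin d) ℂ) (j : Fin d) :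
    ∃ G : MvPolynomial (Fin d) ℂ,
      (∀ r s δ : ℝ, r < s → (∀ x, ‖x‖ ≤ s → ‖polyVal p x‖ ≤ δ) →
        ∀ x, ‖x‖ ≤ r → ‖polyVal G x‖ ≤ δ / (s - r)) ∧
      (∀ h M δ : ℝ, 0 < h → h < 1 → (∀ x, ‖x‖ ≤ 1 → ‖polyVal p x‖ ≤ M) →
        (∀ x, ‖x‖ ≤ √(1 - 2 * h + 2 * h ^ 2) → ‖polyVal p x‖ ≤ δ) →
        ∀ x, ‖x‖ ≤ 1 → ‖((‖x‖ ^ 2 : ℝ) : ℂ) * polyVal G x - starRingEnd ℂ (x j) * polyVal p x‖ ≤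
          2 * √h * M + (1 + 1 / h) * δ) := by
  obtain ⟨G, hG⟩ := exists_radial_primitive (MvPolynomial.pderiv j p)
  refine ⟨G, fun r s δ hrs hδ x hx => ?_, fun h M δ hh0 hh1 hM hδ x hx => ?_⟩
  · have h1 := norm_image_sub_le_of_norm_deriv_le_segment_01' (C := δ / (s - r))
      (fun t _ => ((hG x t).comp_ofReal).hasDerivWithinAt) (fun t ht => ?_)
    · simpa using h1
    rw [← dirDeriv_single]
    refine norm_dirDeriv_le _ _ _ (sub_pos.2 hrs) fun u hu => hδ _ ?_
    calc _ ≤ ‖(t : ℂ) • x‖ + ‖u • EuclideanSpace.single j (1 : ℂ)‖ := norm_add_le _ _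
      _ ≤ r + (s - r) := by
        gcongr
        · rw [norm_smul, Complex.norm_real, Real.norm_of_nonneg ht.1]
          exact (mul_le_of_le_one_left (norm_nonneg _) ht.2.le).trans hx
        · rw [norm_smul, hu]; simp
      _ = s := by ring
  · set F : ℝ → ℂ := fun t => ((‖x‖ ^ 2 : ℝ) : ℂ) * (t * polyVal G ((t : ℂ) • x)) -
      starRingEnd ℂ (x j) * polyVal p ((t : ℂ) • x) with hF
    have hder : ∀ t : ℝ, HasDerivAt F (dirDeriv p ((t : ℂ) • x) (tangentVec j x)) t := by
      intro t
      have h1 := ((hG x t).comp_ofReal).const_mul ((‖x‖ ^ 2 : ℝ) : ℂ)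
      have h2 := ((hasDerivAt_polyVal_line p 0 x t).comp_ofReal).const_mul (starRingEnd ℂ (x j))
      simp only [zero_add] at h2
      rw [tangentVec, dirDeriv_sub_smul, dirDeriv_single]
      exact h1.sub h2
    have hδ0 : 0 ≤ δ := (norm_nonneg _).trans (hδ 0 (by simp))
    have hM0 : 0 ≤ M := (norm_nonneg _).trans (hM 0 (by simp))
    have hsmall : ∀ t : ℝ, 0 ≤ t → t ≤ 1 - h →
        ‖dirDeriv p ((t : ℂ) • x) (tangentVec j x)‖ ≤ δ / h := by
      intro t ht0 ht1
      refine norm_dirDeriv_le _ _ _ hh0 fun u hu => hδ _ (Real.le_sqrt_of_sq_le ?_)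
      refine (norm_smul_add_smul_tangentVec_le j hx _ _).trans ?_
      rw [hu, Complex.norm_real, Real.norm_of_nonneg ht0]
      nlinarith
    have hlarge : ∀ t : ℝ, 0 ≤ t → t < 1 →
        ‖dirDeriv p ((t : ℂ) • x) (tangentVec j x)‖ ≤ M / √(1 - t) := by
      intro t ht0 ht1
      refine norm_dirDeriv_le _ _ _ (Real.sqrt_pos.2 (by linarith)) fun u hu => hM _ ?_
      refine (sq_le_one_iff₀ (norm_nonneg _)).1 ?_
      refine (norm_smul_add_smul_tangentVec_le j hx _ _).trans ?_
      rw [hu, Complex.norm_real, Real.norm_of_nonneg ht0, Real.sq_sqrt (by linarith)]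
      nlinarith
    have hF0 : ‖F 0‖ ≤ δ := by
      have h1 : ‖x j‖ ≤ 1 := (PiLp.norm_apply_le x j).trans hx
      have h2 := hδ 0 (by simp)
      simp only [hF, Complex.ofReal_zero, zero_smul, zero_mul, mul_zero, zero_sub, norm_neg,
        norm_mul, RCLike.norm_conj]
      exact (mul_le_of_le_one_left (norm_nonneg _) h1).trans h2
    have hF1 : ‖F (1 - h) - F 0‖ ≤ δ / h := by
      have := norm_image_sub_le_of_norm_deriv_le_segment' (a := 0) (b := 1 - h) (C := δ / h)
        (fun t _ => (hder t).hasDerivWithinAt) (fun t ht => hsmall t ht.1 ht.2.le) (1 - h)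
        ⟨by linarith, le_rfl⟩
      refine this.trans (mul_le_of_le_one_right (by positivity) (by linarith))
    have hF2 : ‖F 1 - F (1 - h)‖ ≤ 2 * √h * M := by
      have hB : ∀ t : ℝ, t < 1 → HasDerivAt (fun t : ℝ => 2 * √h * M - 2 * M * √(1 - t))
          (M / √(1 - t)) t := by
        intro t ht
        have h1 := ((((hasDerivAt_id t).const_sub 1).sqrt (by simp; linarith)).const_mul
          (2 * M)).const_sub (2 * √h * M)
        refine h1.congr_deriv ?_
        have : √(1 - t) ≠ 0 := (Real.sqrt_pos.2 (by linarith)).ne'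
        simp only [id]
        field_simp
      have := image_norm_le_of_norm_deriv_right_le_deriv_boundary' (a := 1 - h) (b := 1)
        (f := fun t => F t - F (1 - h)) (B := fun t : ℝ => 2 * √h * M - 2 * M * √(1 - t))
        (fun t _ => ((hder t).sub_const _).continuousAt.continuousWithinAt)
        (fun t _ => ((hder t).sub_const _).hasDerivWithinAt) (by simp; linarith)
        (by fun_prop) (fun t ht => (hB t ht.2).hasDerivWithinAt)
        (fun t ht => hlarge t (by linarith [ht.1]) ht.2) (x := 1) ⟨by linarith, le_rfl⟩
      simpa using this
    have hF3 : ((‖x‖ ^ 2 : ℝ) : ℂ) * polyVal G x - starRingEnd ℂ (x j) * polyVal p x =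
        (F 1 - F (1 - h)) + (F (1 - h) - F 0) + F 0 := by
      rw [sub_add_sub_cancel, sub_add_cancel]
      simp [hF]
    rw [hF3]
    calc _ ≤ ‖F 1 - F (1 - h)‖ + ‖F (1 - h) - F 0‖ + ‖F 0‖ := norm_add₃_le
      _ ≤ 2 * √h * M + δ / h + δ := by gcongr
      _ = _ := by ring

lemma exists_conj_mul_approx {d : ℕ} (j : Fin d) {ε : ℝ} (hε : 0 < ε) :
    ∃ r < (1 : ℝ), ∃ N : ℝ, 0 ≤ N ∧ ∀ p : MvPolynomial (Fin d) ℂ, ∃ G : MvPolynomial (Fin d) ℂ,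
      (∀ M, (∀ x, ‖x‖ ≤ 1 → ‖polyVal p x‖ ≤ M) → ∀ x, ‖x‖ ≤ 1 → ‖polyVal G x‖ ≤ 24 * M) ∧
      (∀ s δ, s < 1 → (∀ x, ‖x‖ ≤ (1 + s) / 2 → ‖polyVal p x‖ ≤ δ) →
        ∀ x, ‖x‖ ≤ s → ‖polyVal G x‖ ≤ 2 / (1 - s) * δ) ∧
      (∀ M δ, (∀ x, ‖x‖ ≤ 1 → ‖polyVal p x‖ ≤ M) → (∀ x, ‖x‖ ≤ r → ‖polyVal p x‖ ≤ δ) →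
        ∀ x, ‖x‖ ≤ 1 → ‖polyVal G x - starRingEnd ℂ (x j) * polyVal p x‖ ≤ ε * M + N * δ) := by
  set s : ℝ := 1 - ε / 100 with hs
  have hs1 : s < 1 := by linarith
  set h : ℝ := min (1 / 2) ((ε / 4) ^ 2) with hh
  have hh0 : 0 < h := by positivity
  have hh1 : h ≤ 1 / 2 := min_le_left _ _
  have hhε : √h ≤ ε / 4 := Real.sqrt_le_iff.2 ⟨by positivity, min_le_right _ _⟩
  have hr1 : √(1 - 2 * h + 2 * h ^ 2) < 1 := by
    rw [Real.sqrt_lt' one_pos]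
    nlinarith
  have hN1 : 0 < 2 / (1 - s) := div_pos two_pos (by linarith)
  refine ⟨max ((1 + s) / 2) √(1 - 2 * h + 2 * h ^ 2), max_lt (by linarith) hr1,
    2 / (1 - s) + (1 + 1 / h), by positivity, fun p => ?_⟩
  obtain ⟨G, hA, hB⟩ := exists_conj_mul_approx_aux p j
  have h1 : ∀ M, (∀ x, ‖x‖ ≤ 1 → ‖polyVal p x‖ ≤ M) → ∀ x, ‖x‖ ≤ 1 → ‖polyVal G x‖ ≤ 24 * M := by
    intro M hM x hx
    have hM0 : 0 ≤ M := (norm_nonneg _).trans (hM 0 (by simp))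
    rcases le_or_gt ‖x‖ (1 / 2) with hx2 | hx2
    · have := hA (1 / 2) 1 M (by norm_num) hM x hx2
      norm_num at this
      linarith
    · have hsq : √(1 / 2 : ℝ) ≤ 1 := Real.sqrt_le_one.2 (by norm_num)
      have h3 := hB (1 / 2) M M (by norm_num) (by norm_num) hM
        (fun y hy => hM y (hy.trans (Real.sqrt_le_one.2 (by norm_num)))) x hx
      have h4 : ‖starRingEnd ℂ (x j) * polyVal p x‖ ≤ M := by
        rw [norm_mul, RCLike.norm_conj]
        exact (mul_le_of_le_one_left (norm_nonneg _) ((PiLp.norm_apply_le x j).trans hx)).trans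
          (hM x hx)
      have h5 := norm_le_insert' (((‖x‖ ^ 2 : ℝ) : ℂ) * polyVal G x)
        (starRingEnd ℂ (x j) * polyVal p x)
      have h6 : ‖((‖x‖ ^ 2 : ℝ) : ℂ) * polyVal G x‖ = ‖x‖ ^ 2 * ‖polyVal G x‖ := by
        rw [norm_mul, Complex.norm_real, Real.norm_of_nonneg (by positivity)]
      have h7 : 1 / 4 ≤ ‖x‖ ^ 2 := by nlinarith
      nlinarith [norm_nonneg (polyVal G x)]
  have h2 : ∀ s δ, s < 1 → (∀ x, ‖x‖ ≤ (1 + s) / 2 → ‖polyVal p x‖ ≤ δ) →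
      ∀ x, ‖x‖ ≤ s → ‖polyVal G x‖ ≤ 2 / (1 - s) * δ := by
    intro s δ hs hδ x hx
    refine (hA s _ δ (by linarith) hδ x hx).trans_eq ?_
    have : 1 - s ≠ 0 := by linarith
    rw [show (1 + s) / 2 - s = (1 - s) / 2 by ring]
    field_simp
  refine ⟨G, h1, h2, fun M δ hM hδ x hx => ?_⟩
  have hM0 : 0 ≤ M := (norm_nonneg _).trans (hM 0 (by simp))
  have hδ0 : 0 ≤ δ := (norm_nonneg _).trans
    (hδ 0 (by rw [norm_zero]; exact le_max_of_le_right (Real.sqrt_nonneg _)))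
  have h3 := hB h M δ hh0 (by linarith) hM (fun y hy => hδ y (hy.trans (le_max_right _ _))) x hx
  have hx2 : 0 ≤ 1 - ‖x‖ ^ 2 := by nlinarith [norm_nonneg x]
  have h4 : ‖((1 - ‖x‖ ^ 2 : ℝ) : ℂ) * polyVal G x‖ ≤ ε / 2 * M + 2 / (1 - s) * δ := by
    rw [norm_mul, Complex.norm_real, Real.norm_of_nonneg hx2]
    rcases le_or_gt ‖x‖ s with hxs | hxs
    · have h5 := h2 s δ hs1 (fun y hy => hδ y (hy.trans (le_max_left _ _))) x hxs
      have h6 : (1 - ‖x‖ ^ 2) * ‖polyVal G x‖ ≤ ‖polyVal G x‖ :=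
        mul_le_of_le_one_left (norm_nonneg _) (by nlinarith [norm_nonneg x])
      have : 0 ≤ ε / 2 * M := by positivity
      linarith
    · have h5 : 1 - ‖x‖ ^ 2 ≤ ε / 50 := by nlinarith [norm_nonneg x]
      have h6 := mul_le_mul h5 (h1 M hM x hx) (norm_nonneg _) (by positivity)
      have : 0 ≤ 2 / (1 - s) * δ := by positivity
      nlinarith
  have h5 : polyVal G x - starRingEnd ℂ (x j) * polyVal p x =
      ((1 - ‖x‖ ^ 2 : ℝ) : ℂ) * polyVal G x +
      (((‖x‖ ^ 2 : ℝ) : ℂ) * polyVal G x - starRingEnd ℂ (x j) * polyVal p x) := by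
    push_cast; ring
  rw [h5]
  refine (norm_add_le _ _).trans ?_
  have : 2 * √h * M ≤ ε / 2 * M := by gcongr; linarith
  linarith

/-- The coordinate functions on the closed ball. -/
def coordFun {d : ℕ} (i : Fin d) : C(CB d, ℂ) :=
  ⟨fun z => (z : EuclideanSpace ℂ (Fin d)) i,
    (EuclideanSpace.proj (𝕜 := ℂ) i).continuous.comp continuous_subtype_val⟩

@[simp]
lemma coordFun_apply {d : ℕ} (i : Fin d) (z : CB d) :
    coordFun i z = (z : EuclideanSpace ℂ (Fin d)) i := rfl

/-- Polynomials as continuous functions on the closed ball. -/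
def polyFun (d : ℕ) : MvPolynomial (Fin d) ℂ →ₐ[ℂ] C(CB d, ℂ) := MvPolynomial.aeval coordFun

@[simp]
lemma polyFun_apply {d : ℕ} (p : MvPolynomial (Fin d) ℂ) (z : CB d) :
    polyFun d p z = polyVal p z := by
  induction p using MvPolynomial.induction_on with
  | C a => simp [polyFun, polyVal]
  | add p q hp hq => simp_all [polyVal]
  | mul_X p i hp =>
    have : polyFun d (MvPolynomial.X i) = coordFun i := by simp [polyFun]
    simp_all [polyVal]

lemma polyAlg_eq_range (d : ℕ) : polyAlg d = (polyFun d).range := by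
  rw [polyFun, ← Algebra.adjoin_range_eq_range_aeval, polyAlg]
  congr 1
  ext f
  simp [coordFun, eq_comm]

/-- A linear functional is of Henkin type if, on polynomials, it is controlled by the sup norm on
a smaller ball up to an arbitrarily small multiple of the sup norm. -/
def IsHenkinFunctional {d : ℕ} (L : C(CB d, ℂ) → ℂ) : Prop :=
  ∀ ε > 0, ∃ r < (1 : ℝ), ∃ N : ℝ, 0 ≤ N ∧ ∀ (p : MvPolynomial (Fin d) ℂ) (M δ : ℝ),
    (∀ x, ‖x‖ ≤ 1 → ‖polyVal p x‖ ≤ M) → (∀ x, ‖x‖ ≤ r → ‖polyVal p x‖ ≤ δ) → 0 ≤ δ →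
      ‖L (polyFun d p)‖ ≤ ε * M + N * δ

lemma norm_polyFun_le {d : ℕ} {p : MvPolynomial (Fin d) ℂ} {M : ℝ}
    (hM : ∀ x, ‖x‖ ≤ 1 → ‖polyVal p x‖ ≤ M) : ‖polyFun d p‖ ≤ M :=
  (ContinuousMap.norm_le _ ((norm_nonneg _).trans (hM 0 (by simp)))).2
    fun z => by simpa using hM z (mem_closedBall_zero_iff.1 z.2)

lemma IsHenkinFunctional.mul_coord {d : ℕ} (Λ : C(CB d, ℂ) →L[ℂ] ℂ) {g : C(CB d, ℂ)}
    (hg : IsHenkinFunctional fun f => Λ (f * g)) (j : Fin d) :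
    IsHenkinFunctional fun f => Λ (f * (coordFun j * g)) := by
  intro ε hε
  obtain ⟨r, hr, N, hN, H⟩ := hg ε hε
  refine ⟨r, hr, N, hN, fun p M δ hM hδ hδ0 => ?_⟩
  have hX : polyFun d (MvPolynomial.X j) = coordFun j := by simp [polyFun]
  have hb : ∀ x : EuclideanSpace ℂ (Fin d), ‖x‖ ≤ 1 →
      ‖polyVal (p * MvPolynomial.X j) x‖ ≤ ‖polyVal p x‖ := by
    intro x hx
    simp only [polyVal, map_mul, MvPolynomial.eval_X, norm_mul]
    exact mul_le_of_le_one_right (norm_nonneg _) ((PiLp.norm_apply_le x j).trans hx)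
  have := H (p * MvPolynomial.X j) M δ (fun x hx => (hb x hx).trans (hM x hx))
    (fun x hx => (hb x (hx.trans hr.le)).trans (hδ x hx)) hδ0
  simpa only [map_mul, hX, mul_assoc] using this

lemma IsHenkinFunctional.mul_star_coord {d : ℕ} (Λ : C(CB d, ℂ) →L[ℂ] ℂ) {g : C(CB d, ℂ)}
    (hg : IsHenkinFunctional fun f => Λ (f * g)) (j : Fin d) :
    IsHenkinFunctional fun f => Λ (f * (star (coordFun j) * g)) := by
  intro ε hε
  have hB : 0 < ‖Λ‖ * ‖g‖ + 1 := by positivity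
  obtain ⟨r₁, hr₁, N₁, hN₁, H₁⟩ := hg (ε / 48) (by positivity)
  obtain ⟨r₂, hr₂, N₂, hN₂, H₂⟩ := exists_conj_mul_approx j
    (show 0 < ε / (2 * (‖Λ‖ * ‖g‖ + 1)) by positivity)
  have h1r : 0 < 1 - r₁ := by linarith
  refine ⟨max r₂ ((1 + r₁) / 2), max_lt hr₂ (by linarith),
    N₁ * (2 / (1 - r₁)) + (‖Λ‖ * ‖g‖ + 1) * N₂, by positivity, fun p M δ hM hδ hδ0 => ?_⟩
  obtain ⟨G, hG1, hG2, hG3⟩ := H₂ p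
  have hM0 : 0 ≤ M := (norm_nonneg _).trans (hM 0 (by simp))
  have h1 := H₁ G (24 * M) (2 / (1 - r₁) * δ) (hG1 M hM)
    (hG2 r₁ δ hr₁ fun x hx => hδ x (hx.trans (le_max_right _ _))) (by positivity)
  have h3 := hG3 M δ hM fun x hx => hδ x (hx.trans (le_max_left _ _))
  have h4 : ‖polyFun d G - star (coordFun j) * polyFun d p‖ ≤
      ε / (2 * (‖Λ‖ * ‖g‖ + 1)) * M + N₂ * δ :=
    (ContinuousMap.norm_le _ (by positivity)).2
      fun z => by simpa using h3 z (mem_closedBall_zero_iff.1 z.2)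
  have h5 : Λ (polyFun d p * (star (coordFun j) * g)) = Λ (polyFun d G * g) -
      Λ ((polyFun d G - star (coordFun j) * polyFun d p) * g) := by
    rw [← map_sub]; congr 1; ring
  have h6 : ‖Λ ((polyFun d G - star (coordFun j) * polyFun d p) * g)‖ ≤
      (‖Λ‖ * ‖g‖ + 1) * (ε / (2 * (‖Λ‖ * ‖g‖ + 1)) * M + N₂ * δ) := by
    refine (Λ.le_opNorm _).trans ?_
    have := norm_mul_le (polyFun d G - star (coordFun j) * polyFun d p) g
    calc _ ≤ ‖Λ‖ * ((ε / (2 * (‖Λ‖ * ‖g‖ + 1)) * M + N₂ * δ) * ‖g‖) := by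
          gcongr; exact this.trans (by gcongr)
      _ = ‖Λ‖ * ‖g‖ * (ε / (2 * (‖Λ‖ * ‖g‖ + 1)) * M + N₂ * δ) := by ring
      _ ≤ _ := by gcongr; linarith
  have h7 : (‖Λ‖ * ‖g‖ + 1) * (ε / (2 * (‖Λ‖ * ‖g‖ + 1)) * M + N₂ * δ) =
      ε / 2 * M + (‖Λ‖ * ‖g‖ + 1) * N₂ * δ := by field_simp
  simp only [h5]
  refine (norm_sub_le _ _).trans ?_
  rw [h7] at h6
  linarith

lemma isHenkinFunctional_of_forall_approx {d : ℕ} {L : C(CB d, ℂ) → ℂ}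
    (h : ∀ ε > 0, ∃ L' : C(CB d, ℂ) → ℂ, IsHenkinFunctional L' ∧
      ∀ f, ‖L f - L' f‖ ≤ ε * ‖f‖) : IsHenkinFunctional L := by
  intro ε hε
  obtain ⟨L', hL', happ⟩ := h (ε / 2) (by positivity)
  obtain ⟨r, hr, N, hN, H⟩ := hL' (ε / 2) (by positivity)
  refine ⟨r, hr, N, hN, fun p M δ hM hδ hδ0 => ?_⟩
  have h1 := H p M δ hM hδ hδ0
  have h2 := happ (polyFun d p)
  have h3 := norm_le_insert' (L (polyFun d p)) (L' (polyFun d p))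
  have h4 : ε / 2 * ‖polyFun d p‖ ≤ ε / 2 * M := by gcongr; exact norm_polyFun_le hM
  linarith

lemma IsHenkinFunctional.add {d : ℕ} {L L' : C(CB d, ℂ) → ℂ} (h : IsHenkinFunctional L)
    (h' : IsHenkinFunctional L') : IsHenkinFunctional fun f => L f + L' f := by
  intro ε hε
  obtain ⟨r, hr, N, hN, H⟩ := h (ε / 2) (by positivity)
  obtain ⟨r', hr', N', hN', H'⟩ := h' (ε / 2) (by positivity)
  refine ⟨max r r', max_lt hr hr', N + N', by positivity, fun p M δ hM hδ hδ0 => ?_⟩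
  have h1 := H p M δ hM (fun x hx => hδ x (hx.trans (le_max_left _ _))) hδ0
  have h2 := H' p M δ hM (fun x hx => hδ x (hx.trans (le_max_right _ _))) hδ0
  have h3 := norm_add_le (L (polyFun d p)) (L' (polyFun d p))
  linarith

lemma IsHenkinFunctional.const_mul {d : ℕ} {L : C(CB d, ℂ) → ℂ} (h : IsHenkinFunctional L)
    (c : ℂ) : IsHenkinFunctional fun f => c * L f := by
  intro ε hε
  obtain ⟨r, hr, N, hN, H⟩ := h (ε / (‖c‖ + 1)) (by positivity)
  refine ⟨r, hr, ‖c‖ * N, by positivity, fun p M δ hM hδ hδ0 => ?_⟩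
  have hM0 : 0 ≤ M := (norm_nonneg _).trans (hM 0 (by simp))
  have h1 := H p M δ hM hδ hδ0
  rw [norm_mul]
  calc _ ≤ ‖c‖ * (ε / (‖c‖ + 1) * M + N * δ) := by gcongr
    _ = (‖c‖ / (‖c‖ + 1)) * (ε * M) + ‖c‖ * N * δ := by ring
    _ ≤ 1 * (ε * M) + ‖c‖ * N * δ := by
      gcongr
      rw [div_le_one (by positivity)]
      linarith
    _ = _ := by ring

/-- Multiplying a functional annihilating the polynomials by a continuous function gives a
functional of Henkin type. -/
theorem isHenkinFunctional_mul {d : ℕ} (Λ : C(CB d, ℂ) →L[ℂ] ℂ)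
    (hΛ : ∀ p, Λ (polyFun d p) = 0) (g : C(CB d, ℂ)) :
    IsHenkinFunctional fun f => Λ (f * g) := by
  let A : Subalgebra ℂ C(CB d, ℂ) :=
    { carrier := {h | ∀ g, (IsHenkinFunctional fun f => Λ (f * g)) →
        IsHenkinFunctional fun f => Λ (f * (h * g))}
      mul_mem' := fun {a b} ha hb g hg => by simpa only [mul_assoc] using ha _ (hb g hg)
      add_mem' := fun {a b} ha hb g hg => by
        simpa only [add_mul, mul_add, map_add] using (ha g hg).add (hb g hg)
      algebraMap_mem' := fun c g hg => by
        simpa [Algebra.algebraMap_eq_smul_one] using hg.const_mul c }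
  let S : StarSubalgebra ℂ C(CB d, ℂ) := StarAlgebra.adjoin ℂ (range coordFun)
  have hSA : S.toSubalgebra ≤ A := by
    rw [StarAlgebra.adjoin_toSubalgebra]
    refine Algebra.adjoin_le ?_
    rintro f (⟨j, rfl⟩ | hf)
    · exact fun g hg => hg.mul_coord Λ j
    · obtain ⟨j, hj⟩ := hf
      obtain rfl : star (coordFun j) = f := by rw [hj, star_star]
      exact fun g hg => hg.mul_star_coord Λ j
  have hS : S.topologicalClosure = ⊤ := by
    refine ContinuousMap.starSubalgebra_topologicalClosure_eq_top_of_separatesPoints S ?_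
    intro x y hxy
    have : ∃ j, (x : EuclideanSpace ℂ (Fin d)) j ≠ (y : EuclideanSpace ℂ (Fin d)) j := by
      by_contra! h
      exact hxy (Subtype.ext (PiLp.ext h))
    obtain ⟨j, hj⟩ := this
    exact ⟨coordFun j, ⟨coordFun j, StarAlgebra.subset_adjoin ℂ _ ⟨j, rfl⟩, rfl⟩, hj⟩
  have hone : IsHenkinFunctional fun f => Λ (f * 1) := fun ε hε =>
    ⟨0, one_pos, 0, le_rfl, fun p M δ hM _ _ => by
      have hM0 : 0 ≤ M := (norm_nonneg _).trans (hM 0 (by simp))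
      simp only [mul_one, hΛ, norm_zero]
      positivity⟩
  refine isHenkinFunctional_of_forall_approx fun ε hε => ?_
  have hg : g ∈ closure (S : Set C(CB d, ℂ)) := by
    rw [← StarSubalgebra.topologicalClosure_coe, hS]
    trivial
  obtain ⟨g', hg', hgg'⟩ := Metric.mem_closure_iff.1 hg (ε / (‖Λ‖ + 1)) (by positivity)
  refine ⟨fun f => Λ (f * g'), by simpa using hSA hg' 1 hone, fun f => ?_⟩
  rw [← map_sub, ← mul_sub]
  rw [dist_eq_norm] at hgg'
  calc _ ≤ ‖Λ‖ * (‖f‖ * (ε / (‖Λ‖ + 1))) := by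
        refine (Λ.le_opNorm _).trans ?_
        gcongr
        exact (norm_mul_le _ _).trans (by gcongr)
    _ = (‖Λ‖ / (‖Λ‖ + 1)) * (ε * ‖f‖) := by ring
    _ ≤ 1 * (ε * ‖f‖) := by
      gcongr
      rw [div_le_one (by positivity)]
      linarith
    _ = _ := one_mul _

lemma norm_polyVal_sub_le {d : ℕ} {p : MvPolynomial (Fin d) ℂ} {M r : ℝ} (hr : r < 1)
    (hM : ∀ x, ‖x‖ ≤ 1 → ‖polyVal p x‖ ≤ M) {x y : EuclideanSpace ℂ (Fin d)}
    (hx : ‖x‖ ≤ r) (hy : ‖y‖ ≤ r) :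
    ‖polyVal p x - polyVal p y‖ ≤ M / (1 - r) * ‖x - y‖ := by
  rcases eq_or_ne x y with rfl | hxy
  · simp
  have hn : 0 < ‖x - y‖ := norm_pos_iff.2 (sub_ne_zero.2 hxy)
  let S : Set ℂ := {s | ‖y + s • (x - y)‖ ≤ r}
  have hS : Convex ℝ S := by
    intro a ha b hb α β hα hβ hαβ
    have : y + (α • a + β • b) • (x - y) =
        α • (y + a • (x - y)) + β • (y + b • (x - y)) := by
      have hy : y = α • y + β • y := by rw [← add_smul, hαβ, one_smul]
      rw [add_smul, smul_assoc, smul_assoc, smul_add, smul_add]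
      nth_rewrite 1 [hy]
      abel
    change ‖_‖ ≤ r
    rw [this]
    refine (norm_add_le _ _).trans ?_
    rw [norm_smul, norm_smul, Real.norm_of_nonneg hα, Real.norm_of_nonneg hβ]
    calc _ ≤ α * r + β * r := add_le_add (mul_le_mul_of_nonneg_left ha hα)
          (mul_le_mul_of_nonneg_left hb hβ)
      _ = r := by rw [← add_mul, hαβ, one_mul]
  have h := hS.norm_image_sub_le_of_norm_hasDerivWithin_le
    (f := fun s : ℂ => polyVal p (y + s • (x - y))) (C := M / ((1 - r) / ‖x - y‖))
    (fun s _ => (hasDerivAt_polyVal_line p y (x - y) s).hasDerivWithinAt)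
    (fun s hs => norm_dirDeriv_le p _ _ (div_pos (by linarith) hn) fun t ht => hM _ <| by
      refine (norm_add_le _ _).trans ?_
      rw [norm_smul, ht, div_mul_cancel₀ _ hn.ne']
      have : ‖y + s • (x - y)‖ ≤ r := hs
      linarith)
    (show (0 : ℂ) ∈ S by simpa [S] using hy) (show (1 : ℂ) ∈ S by simpa [S] using hx)
  simp only [one_smul, zero_smul, add_zero, add_sub_cancel, sub_zero, norm_one, mul_one] at h
  refine h.trans_eq ?_
  rw [div_div_eq_mul_div, div_mul_eq_mul_div]

lemma eventually_norm_polyVal_le {d : ℕ} {p : ℕ → MvPolynomial (Fin d) ℂ} {C : ℝ}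
    (hC : ∀ n x, ‖x‖ ≤ 1 → ‖polyVal (p n) x‖ ≤ C)
    (hp : ∀ x, ‖x‖ < 1 → Tendsto (fun n => polyVal (p n) x) atTop (𝓝 0))
    {r : ℝ} (hr : r < 1) {δ : ℝ} (hδ : 0 < δ) :
    ∀ᶠ n in atTop, ∀ x, ‖x‖ ≤ r → ‖polyVal (p n) x‖ ≤ δ := by
  have hC0 : 0 ≤ C := (norm_nonneg _).trans (hC 0 0 (by simp))
  have h1r : 0 < 1 - r := by linarith
  obtain ⟨t, htr, htf, ht⟩ := (isCompact_closedBall (0 : EuclideanSpace ℂ (Fin d)) r).finite_cover_balls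
    (show 0 < δ / 2 / (C / (1 - r) + 1) by positivity)
  have h : ∀ᶠ n in atTop, ∀ y ∈ t, ‖polyVal (p n) y‖ ≤ δ / 2 := by
    refine (eventually_all_finite htf).2 fun y hy => ?_
    have := (hp y ((mem_closedBall_zero_iff.1 (htr hy)).trans_lt hr)).norm
    rw [norm_zero] at this
    exact this.eventually_le_const (half_pos hδ)
  filter_upwards [h] with n hn x hx
  obtain ⟨y, hy, hxy⟩ := mem_iUnion₂.1 (ht (mem_closedBall_zero_iff.2 hx))
  have h1 := norm_polyVal_sub_le hr (hC n) hx (mem_closedBall_zero_iff.1 (htr hy))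
  have h2 : C / (1 - r) * ‖x - y‖ ≤ δ / 2 := by
    rw [mem_ball, dist_eq_norm, lt_div_iff₀ (by positivity)] at hxy
    nlinarith [norm_nonneg (x - y)]
  have h3 := norm_le_insert' (polyVal (p n) x) (polyVal (p n) y)
  linarith [hn y hy]

lemma mem_ballAlg_iff {d : ℕ} {f : C(CB d, ℂ)} :
    f ∈ ballAlg d ↔ ∀ ε > 0, ∃ p, ‖f - polyFun d p‖ < ε := by
  change f ∈ (ballAlgSub d : Set C(CB d, ℂ)) ↔ _
  rw [ballAlgSub, Subalgebra.topologicalClosure_coe, polyAlg_eq_range, Metric.mem_closure_iff]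
  simp [dist_eq_norm]

lemma polyFun_mem_ballAlg {d : ℕ} (p : MvPolynomial (Fin d) ℂ) : polyFun d p ∈ ballAlg d :=
  mem_ballAlg_iff.2 fun ε hε => ⟨p, by simpa⟩

lemma tendsto_mul_of_annihilates {d : ℕ} (Λ : C(CB d, ℂ) →L[ℂ] ℂ)
    (hΛ : ∀ p, Λ (polyFun d p) = 0) (g : C(CB d, ℂ)) {f : ℕ → C(CB d, ℂ)}
    (hf : ∀ n, f n ∈ ballAlg d) {C : ℝ} (hC : ∀ n, ‖f n‖ ≤ C)
    (hf0 : ∀ z ∈ openD d, Tendsto (fun n => f n z) atTop (𝓝 0)) :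
    Tendsto (fun n => Λ (f n * g)) atTop (𝓝 0) := by
  choose p hp using fun n : ℕ =>
    mem_ballAlg_iff.1 (hf n) (1 / ((n : ℝ) + 1)) Nat.one_div_pos_of_nat
  have hlim : Tendsto (fun n => f n - polyFun d (p n)) atTop (𝓝 0) :=
    squeeze_zero_norm (fun n => (hp n).le) tendsto_one_div_add_atTop_nhds_zero_nat
  have hsub : Tendsto (fun n => Λ ((f n - polyFun d (p n)) * g)) atTop (𝓝 0) := by
    have := (Λ.continuous.tendsto _).comp (hlim.mul_const g)
    simpa [Function.comp_def] using this
  suffices h : Tendsto (fun n => Λ (polyFun d (p n) * g)) atTop (𝓝 0) by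
    have h2 := hsub.add h
    simpa only [← map_add, sub_mul, sub_add_cancel, add_zero] using h2
  have hpC : ∀ n x, ‖x‖ ≤ 1 → ‖polyVal (p n) x‖ ≤ C + 1 := by
    intro n x hx
    have h1 := (polyFun d (p n)).norm_coe_le_norm ⟨x, mem_closedBall_zero_iff.2 hx⟩
    rw [polyFun_apply] at h1
    have h3 : 1 / ((n : ℝ) + 1) ≤ 1 := by
      rw [div_le_one (by positivity)]; linarith [n.cast_nonneg (α := ℝ)]
    have h4 := hp n
    have h5 := hC n
    have h6 := norm_sub_norm_le (polyFun d (p n)) (f n)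
    rw [norm_sub_rev] at h6
    exact h1.trans (by linarith)
  have hp0 : ∀ x, ‖x‖ < 1 → Tendsto (fun n => polyVal (p n) x) atTop (𝓝 0) := by
    intro x hx
    let z : CB d := ⟨x, mem_closedBall_zero_iff.2 hx.le⟩
    have h1 := hf0 z hx
    have h2 := ((continuous_eval_const (F := C(CB d, ℂ)) z).tendsto _).comp hlim
    have h3 := h1.sub h2
    simpa [z, Function.comp_def] using h3
  have hC0 : 0 ≤ C + 1 := (norm_nonneg _).trans (hpC 0 0 (by simp))
  rw [Metric.tendsto_nhds]
  intro ε hε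
  obtain ⟨r, hr, N, hN, H⟩ := isHenkinFunctional_mul Λ hΛ g (ε / (4 * (C + 1 + 1))) (by positivity)
  filter_upwards [eventually_norm_polyVal_le hpC hp0 hr
    (show 0 < ε / (4 * (N + 1)) by positivity)] with n hn
  rw [dist_zero_right]
  refine (H (p n) (C + 1) _ (hpC n) hn (by positivity)).trans_lt ?_
  have h1 : ε / (4 * (C + 1 + 1)) * (C + 1) ≤ ε / 4 := by
    rw [div_mul_eq_mul_div, div_le_iff₀ (by positivity)]
    nlinarith
  have h2 : N * (ε / (4 * (N + 1))) ≤ ε / 4 := by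
    rw [mul_div_assoc', div_le_iff₀ (by positivity)]
    nlinarith
  linarith

lemma exists_density_map {X Y : Type*} [mX : MeasurableSpace X] [MeasurableSpace Y] (μ : Measure Y)
    [IsFiniteMeasure μ] {π : Y → X} (hπ : Measurable π) {c : Y → ℂ} (hc : Integrable c μ) :
    ∃ θ : X → ℂ, StronglyMeasurable θ ∧ Integrable θ (μ.map π) ∧
      ∀ h : X → ℂ, StronglyMeasurable h → (∃ C, ∀ x, ‖h x‖ ≤ C) →
        ∫ x, h x * θ x ∂μ.map π = ∫ y, h (π y) * c y ∂μ := by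
  obtain ⟨θ, hθ, hθc⟩ := StronglyMeasurable.exists_eq_measurable_comp
    (stronglyMeasurable_condExp (f := c) (m := mX.comap π) (μ := μ))
  have hθi : Integrable θ (μ.map π) := by
    rw [integrable_map_measure hθ.aestronglyMeasurable hπ.aemeasurable, ← hθc]
    exact integrable_condExp
  refine ⟨θ, hθ, hθi, fun h hh ⟨C, hC⟩ => ?_⟩
  have hhπ : StronglyMeasurable[mX.comap π] fun y => h (π y) :=
    hh.comp_measurable (comap_measurable π)
  have hi : Integrable (fun y => h (π y) * c y) μ :=
    hc.bdd_mul (hh.comp_measurable hπ).aestronglyMeasurable (.of_forall fun y => hC (π y))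
  rw [integral_map (f := fun x => h x * θ x) hπ.aemeasurable (hh.mul hθ).aestronglyMeasurable,
    ← integral_condExp (m := mX.comap π) hπ.comap_le (f := fun y => h (π y) * c y)]
  refine integral_congr_ae ?_
  filter_upwards [condExp_bilin_of_stronglyMeasurable_left (ContinuousLinearMap.mul ℝ ℂ)
    (m := mX.comap π) hhπ hi hc] with y hy
  rw [ContinuousLinearMap.mul_apply'] at hy
  rw [← show θ (π y) = (μ[c | mX.comap π]) y from (congrFun hθc y).symm] at hy
  exact hy.symm

/-- A measure on a space over the closed ball which annihilates the ball algebra does not charge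
the preimages of totally null sets. -/
theorem setIntegral_preimage_eq_zero {d : ℕ} {Y : Type*} [TopologicalSpace Y] [CompactSpace Y]
    [MeasurableSpace Y] [BorelSpace Y] (μ : Measure Y) [IsFiniteMeasure μ]
    {π : Y → CB d} (hπ : Continuous π) {c : Y → ℂ} (hc : Continuous c)
    (hann : ∀ f ∈ ballAlg d, ∫ y, f (π y) * c y ∂μ = 0)
    {K : Set (CB d)} (hK : MeasurableSet K) (hKnull : IsTotallyNull d K) :
    ∫ y in π ⁻¹' K, c y ∂μ = 0 := by
  obtain ⟨B, hB⟩ : ∃ B, ∀ y, ‖c y‖ ≤ B := by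
    obtain ⟨B, hB⟩ := (isCompact_range hc).isBounded.exists_norm_le
    exact ⟨B, fun y => hB _ ⟨y, rfl⟩⟩
  have hci : Integrable c μ :=
    .of_bound hc.aestronglyMeasurable B (.of_forall hB)
  obtain ⟨θ, hθ, hθi, hθc⟩ := exists_density_map μ hπ.measurable hci
  set τ := μ.map π with hτ
  have : IsFiniteMeasure τ := Measure.isFiniteMeasure_map μ π
  have hcont : ∀ f : C(CB d, ℂ), Integrable (fun y => f (π y) * c y) μ := fun f =>
    hci.bdd_mul (f.continuous.comp hπ).aestronglyMeasurable
      (.of_forall fun y => f.norm_coe_le_norm (π y))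
  let Λ : C(CB d, ℂ) →L[ℂ] ℂ := LinearMap.mkContinuous
    { toFun := fun f => ∫ y, f (π y) * c y ∂μ
      map_add' := fun f g => by
        simp only [ContinuousMap.add_apply, add_mul]
        exact integral_add (hcont f) (hcont g)
      map_smul' := fun a f => by
        simp only [ContinuousMap.smul_apply, smul_eq_mul, mul_assoc, RingHom.id_apply]
        exact integral_const_mul a _ } (∫ y, ‖c y‖ ∂μ) fun f => by
      refine (norm_integral_le_integral_norm _).trans ?_
      rw [mul_comm, ← integral_const_mul]
      refine integral_mono (hcont f).norm (hci.norm.const_mul _) fun y => ?_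
      simp only [norm_mul]
      gcongr
      exact f.norm_coe_le_norm (π y)
  have hΛ : ∀ f, Λ f = ∫ y, f (π y) * c y ∂μ := fun _ => rfl
  have hΛ0 : ∀ p, Λ (polyFun d p) = 0 := fun p => hann _ (polyFun_mem_ballAlg p)
  let g : CB d → ℂ := K.indicator fun z => starRingEnd ℂ (θ z) / ‖θ z‖
  have hg : StronglyMeasurable g := by
    refine Measurable.stronglyMeasurable (Measurable.indicator ?_ hK)
    exact (Complex.continuous_conj.measurable.comp hθ.measurable).div
      (Complex.measurable_ofReal.comp hθ.measurable.norm)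
  have hg1 : ∀ z, ‖g z‖ ≤ 1 := fun z => by
    refine (norm_indicator_le_norm_self _ _).trans ?_
    simp only [norm_div, RCLike.norm_conj, Complex.norm_real, norm_norm]
    exact div_self_le_one _
  have hgθ : ∀ z, g z * θ z = K.indicator (fun z => (‖θ z‖ : ℂ)) z := fun z => by
    by_cases hz : z ∈ K
    · simp only [g, indicator_of_mem hz]
      rcases eq_or_ne (θ z) 0 with h0 | h0
      · simp [h0]
      · rw [div_mul_eq_mul_div, mul_comm, Complex.mul_conj, Complex.normSq_eq_norm_sq]
        have : (‖θ z‖ : ℂ) ≠ 0 := by simpa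
        push_cast
        field_simp
    · simp [g, hz]
  have hgi : Integrable g τ := .of_bound hg.aestronglyMeasurable 1 (.of_forall hg1)
  set κ : Measure (CB d) := (τ.restrict K).withDensity fun z => (‖θ z‖₊ : ENNReal) with hκ
  have hθK : Integrable θ (τ.restrict K) := hθi.restrict
  have hκfin : IsFiniteMeasure κ := isFiniteMeasure_withDensity hθK.hasFiniteIntegral.ne
  have hκint : ∀ f : C(CB d, ℂ), ∫ z, f z ∂κ = ∫ y, (f (π y) * g (π y)) * c y ∂μ := by
    intro f
    rw [hκ, integral_withDensity_eq_integral_smul hθ.measurable.nnnorm, ← integral_indicator hK]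
    rw [← hθc (fun z => f z * g z) (f.continuous.stronglyMeasurable.mul hg)
      ⟨‖f‖ * 1, fun z => by rw [norm_mul]; gcongr; exacts [f.norm_coe_le_norm z, hg1 z]⟩]
    refine integral_congr_ae (.of_forall fun z => ?_)
    simp only [mul_assoc, hgθ]
    by_cases hz : z ∈ K
    · simp [hz, NNReal.smul_def, mul_comm]
    · simp [hz]
  have hκH : IsHenkin d κ := by
    refine ⟨hκfin, inferInstance, ?_, fun f hf ⟨C, hC⟩ hf0 => ?_⟩
    · have hd : (sphereD d)ᶜ ⊆ Kᶜ := compl_subset_compl.2 hKnull.1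
      refine measure_mono_null hd (withDensity_absolutelyContinuous _ _ ?_)
      rw [Measure.restrict_apply hK.compl, compl_inter_self, measure_empty]
    · have hC0 : 0 ≤ C := (norm_nonneg _).trans (hC 0)
      rw [Metric.tendsto_nhds]
      intro ε hε
      obtain ⟨g', hg', hg'i⟩ := hgi.exists_boundedContinuous_integral_sub_le
        (show 0 < ε / (2 * (C * |B| + 1)) by positivity)
      have hlim := tendsto_mul_of_annihilates Λ hΛ0 g'.toContinuousMap hf hC hf0
      filter_upwards [Metric.tendsto_nhds.1 hlim (ε / 2) (half_pos hε)] with n hn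
      rw [dist_zero_right] at hn ⊢
      rw [hκint]
      have hfi : Integrable (fun y => (f n (π y) * g (π y)) * c y) μ := by
        refine hci.bdd_mul (c := C * 1) ?_ (.of_forall fun y => ?_)
        · exact (((f n).continuous.comp hπ).stronglyMeasurable.mul
            (hg.comp_measurable hπ.measurable)).aestronglyMeasurable
        · rw [norm_mul]
          gcongr
          exacts [((f n).norm_coe_le_norm _).trans (hC n), hg1 _]
      have hsub : ∫ y, (f n (π y) * g (π y)) * c y ∂μ - Λ (f n * g'.toContinuousMap) =
          ∫ y, (f n (π y) * c y) * (g (π y) - g' (π y)) ∂μ := by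
        rw [hΛ, ← integral_sub hfi (hcont _)]
        refine integral_congr_ae (.of_forall fun y => ?_)
        simp only [ContinuousMap.mul_apply, BoundedContinuousFunction.coe_toContinuousMap]
        ring
      have hgg : Integrable (fun y => ‖g (π y) - g' (π y)‖) μ :=
        ((integrable_map_measure (hgi.sub hg'i).aestronglyMeasurable
          hπ.measurable.aemeasurable).1 (hgi.sub hg'i)).norm
      have hbd : ‖∫ y, (f n (π y) * c y) * (g (π y) - g' (π y)) ∂μ‖ ≤
          C * |B| * ∫ z, ‖g z - g' z‖ ∂τ := by
        rw [hτ, integral_map (f := fun z => ‖g z - g' z‖) hπ.measurable.aemeasurable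
          (hgi.sub hg'i).norm.aestronglyMeasurable, ← integral_const_mul]
        refine norm_integral_le_of_norm_le (hgg.const_mul _) (.of_forall fun y => ?_)
        rw [norm_mul, norm_mul]
        gcongr
        exacts [((f n).norm_coe_le_norm _).trans (hC n), (hB y).trans (le_abs_self B)]
      have h3 : C * |B| * (ε / (2 * (C * |B| + 1))) ≤ ε / 2 := by
        rw [mul_div_assoc', div_le_iff₀ (by positivity)]
        nlinarith
      have h4 : C * |B| * ∫ z, ‖g z - g' z‖ ∂τ ≤ ε / 2 :=
        (mul_le_mul_of_nonneg_left hg' (by positivity)).trans h3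
      rw [← hsub] at hbd
      have h5 := norm_le_insert' (∫ y, (f n (π y) * g (π y)) * c y ∂μ)
        (Λ (f n * g'.toContinuousMap))
      linarith
  have hzero : κ K = 0 := hKnull.2 κ hκH
  rw [hκ, withDensity_apply _ hK, Measure.restrict_restrict hK, inter_self,
    lintegral_eq_zero_iff hθ.measurable.nnnorm.coe_nnreal_ennreal] at hzero
  have h1 := hθc (K.indicator 1) (stronglyMeasurable_one.indicator hK)
    ⟨1, fun z => (norm_indicator_le_norm_self _ _).trans (by simp)⟩
  rw [← integral_indicator (hπ.measurable hK)]
  calc ∫ y, (π ⁻¹' K).indicator c y ∂μ = ∫ y, K.indicator 1 (π y) * c y ∂μ := by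
        refine integral_congr_ae (.of_forall fun y => ?_)
        by_cases hy : π y ∈ K <;> simp [hy]
    _ = ∫ z, K.indicator 1 z * θ z ∂τ := h1.symm
    _ = ∫ z in K, θ z ∂τ := by
      rw [← integral_indicator hK]
      refine integral_congr_ae (.of_forall fun z => ?_)
      by_cases hz : z ∈ K <;> simp [hz]
    _ = 0 := by
      refine integral_eq_zero_of_ae ?_
      filter_upwards [hzero] with z hz
      simpa using hz

/-- A positive functional on the continuous functions on a compact space is given by a measure. -/
lemma exists_measure_eq_integral {Y : Type*} [TopologicalSpace Y] [CompactSpace Y] [T2Space Y]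
    [MeasurableSpace Y] [BorelSpace Y] (L : C(Y, ℝ) →ₗ[ℝ] ℝ) (hL : ∀ f, (∀ y, 0 ≤ f y) → 0 ≤ L f) :
    ∃ μ : Measure Y, IsFiniteMeasure μ ∧ ∀ f : C(Y, ℝ), L f = ∫ y, f y ∂μ := by
  let Λ : CompactlySupportedContinuousMap Y ℝ →ₚ[ℝ] ℝ :=
    { toFun := fun f => L f
      map_add' := fun f g => L.map_add f g
      map_smul' := fun c f => L.map_smul c f
      monotone' := fun f g hfg => by
        have h := hL ((g : C(Y, ℝ)) - f) fun y => sub_nonneg.2 (hfg y)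
        rwa [map_sub, sub_nonneg] at h }
  refine ⟨RealRMK.rieszMeasure Λ, inferInstance, fun f => ?_⟩
  exact (RealRMK.integral_rieszMeasure Λ
    (CompactlySupportedContinuousMap.continuousMapEquiv f)).symm

/-- If a system of strict linear inequalities indexed by a compact space has no solution, then this
is witnessed by a measure. -/
theorem exists_measure_of_forall_exists_le {Y V : Type*} [TopologicalSpace Y] [CompactSpace Y]
    [T2Space Y] [MeasurableSpace Y] [BorelSpace Y] [AddCommGroup V] [Module ℝ V]
    (T : V →ₗ[ℝ] C(Y, ℝ)) (ψ : C(Y, ℝ)) (h : ∀ v, ∃ y, ψ y ≤ T v y) :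
    ∃ μ : Measure Y, IsFiniteMeasure μ ∧ μ ≠ 0 ∧ (∀ v, ∫ y, T v y ∂μ = 0) ∧ ∫ y, ψ y ∂μ ≤ 0 := by
  have : Nonempty Y := ⟨(h 0).choose⟩
  let s : Set C(Y, ℝ) := {φ | ∀ y, φ y < 0}
  have hs : Convex ℝ s := by
    intro a ha b hb α β hα hβ hαβ y
    have h1 := ha y
    have h2 := hb y
    change α * a y + β * b y < 0
    rcases hα.eq_or_lt with rfl | hα
    · simp_all
    · nlinarith
  have hso : IsOpen s := by
    have : s = {φ : C(Y, ℝ) | MapsTo φ univ (Iio 0)} := by ext; simp [s, MapsTo]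
    rw [this]
    exact ContinuousMap.isOpen_setOfPred_mapsTo isCompact_univ isOpen_Iio
  let t : Set C(Y, ℝ) := range fun v => T v - ψ
  have ht : Convex ℝ t := by
    rintro _ ⟨v, rfl⟩ _ ⟨w, rfl⟩ α β - - hαβ
    refine ⟨α • v + β • w, ?_⟩
    have : ψ = α • ψ + β • ψ := by rw [← add_smul, hαβ, one_smul]
    simp only [map_add, map_smul, smul_sub]
    nth_rewrite 1 [this]
    abel
  have hst : Disjoint s t := by
    rw [Set.disjoint_left]
    rintro _ hv ⟨v, rfl⟩
    obtain ⟨y, hy⟩ := h v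
    have := hv y
    simp only [ContinuousMap.sub_apply] at this
    linarith
  obtain ⟨f, u, hfs, hft⟩ := geometric_hahn_banach_open hs hso ht hst
  have hscale : ∀ a ∈ s, ∀ l : ℝ, 0 < l → l * f a < u := fun a ha l hl => by
    have := hfs (l • a) fun y => mul_neg_of_pos_of_neg hl (ha y)
    rwa [map_smul] at this
  have hone : (-1 : C(Y, ℝ)) ∈ s := fun y => by simp
  have hu : 0 ≤ u := by
    have h0 : Tendsto (fun l : ℝ => l * f (-1)) (𝓝[>] 0) (𝓝 (0 * f (-1))) :=
      ((continuous_id.mul continuous_const).tendsto _).mono_left nhdsWithin_le_nhds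
    rw [zero_mul] at h0
    refine le_of_tendsto h0 ?_
    filter_upwards [self_mem_nhdsWithin] with l hl using (hscale _ hone l hl).le
  have hneg : ∀ a ∈ s, f a ≤ 0 := fun a ha => by
    by_contra! hpos
    have := hscale a ha (u / f a + 1) (by positivity)
    rw [add_mul, div_mul_cancel₀ _ hpos.ne', one_mul] at this
    linarith
  have hpos : ∀ φ : C(Y, ℝ), (∀ y, 0 ≤ φ y) → 0 ≤ f φ := fun φ hφ => by
    have h0 : Tendsto (fun l : ℝ => f (-φ + l • (-1))) (𝓝[>] 0) (𝓝 (f (-φ + (0 : ℝ) • (-1)))) :=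
      ((f.continuous.comp (by fun_prop)).tendsto _).mono_left nhdsWithin_le_nhds
    have h1 : f (-φ + (0 : ℝ) • (-1)) ≤ 0 := by
      refine le_of_tendsto h0 ?_
      filter_upwards [self_mem_nhdsWithin] with l (hl : 0 < l)
      refine hneg _ fun y => ?_
      have := hφ y
      simp
      linarith
    simpa using h1
  obtain ⟨μ, hμ, hμf⟩ := exists_measure_eq_integral (f : C(Y, ℝ) →ₗ[ℝ] ℝ) hpos
  have hle : ∀ v, f ψ ≤ f (T v) := fun v => by
    have := hft _ ⟨v, rfl⟩
    rw [map_sub] at this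
    linarith
  have hT : ∀ v, f (T v) = 0 := fun v => by
    by_contra hne
    have := hle (((f ψ - 1) / f (T v)) • v)
    rw [map_smul, map_smul, smul_eq_mul, div_mul_cancel₀ _ hne] at this
    linarith
  refine ⟨μ, hμ, ?_, fun v => (hμf _).symm.trans (hT v), ?_⟩
  · rintro rfl
    have h0 : ∀ φ, f φ = 0 := fun φ => by simpa using hμf φ
    have h1 := hfs _ hone
    have h2 := hft _ ⟨0, rfl⟩
    rw [h0] at h1 h2
    linarith
  · rw [← hμf]
    exact (hle 0).trans_eq (hT 0)

/-- Peak functions: a compact totally null set admits almost nonnegative functions of the ball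
algebra which are almost dominated by a given function equal to one on the set. -/
lemma exists_peak_re_im {d : ℕ} {K : Set (CB d)} (hK : IsCompact K) (hKnull : IsTotallyNull d K)
    (u : C(CB d, ℝ)) (hu : ∀ z, 0 ≤ u z) (huK : ∀ z ∈ K, u z = 1) {η : ℝ} (hη : 0 < η) :
    ∃ q ∈ ballAlg d, (∀ z, -η < (q z).re ∧ (q z).re < η + u z ∧ |(q z).im| < η) ∧
      ∀ z ∈ K, 1 - η < (q z).re := by
  let Y := {y : Fin 5 × CB d // y.1 = 4 → y.2 ∈ K}
  have hY : IsClosed {y : Fin 5 × CB d | y.1 = 4 → y.2 ∈ K} := by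
    have : {y : Fin 5 × CB d | y.1 = 4 → y.2 ∈ K} =
        Prod.fst ⁻¹' {4}ᶜ ∪ Prod.snd ⁻¹' K := by
      ext y; simp [imp_iff_not_or]
    rw [this]
    exact ((isClosed_discrete _).preimage continuous_fst).union
      (hK.isClosed.preimage continuous_snd)
  have : CompactSpace Y := isCompact_iff_compactSpace.1 hY.isCompact
  let : MeasurableSpace Y := borel Y
  have : BorelSpace Y := ⟨rfl⟩
  let a : Fin 5 → ℝ := ![η, η, η, η, η - 1]
  let b : Fin 5 → ℝ := ![1, 0, 0, 0, 0]
  let c : Fin 5 → ℂ := ![1, -1, -Complex.I, Complex.I, -1]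
  have hi : Continuous fun y : Y => y.1.1 := continuous_fst.comp continuous_subtype_val
  have hπ : Continuous fun y : Y => y.1.2 := continuous_snd.comp continuous_subtype_val
  have hc : Continuous fun y : Y => c y.1.1 := continuous_of_discreteTopology.comp hi
  let ψ : C(Y, ℝ) := ⟨fun y => a y.1.1 + b y.1.1 * u y.1.2,
    (continuous_of_discreteTopology.comp hi).add
      ((continuous_of_discreteTopology.comp hi).mul (u.continuous.comp hπ))⟩
  let T : ballAlgSub d →ₗ[ℝ] C(Y, ℝ) :=
    { toFun := fun q => ⟨fun y => (q.1 y.1.2 * c y.1.1).re,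
        Complex.continuous_re.comp ((q.1.continuous.comp hπ).mul hc)⟩
      map_add' := fun q r => by ext y; simp [add_mul]
      map_smul' := fun l q => by ext y; simp; ring }
  by_cases hex : ∃ q, ∀ y, T q y < ψ y
  · obtain ⟨q, hq⟩ := hex
    have h0 : ∀ (i : Fin 5) (z : CB d), (i = 4 → z ∈ K) →
        (q.1 z * c i).re < a i + b i * u z := fun i z h => hq ⟨(i, z), h⟩
    refine ⟨q.1, q.2, fun z => ⟨?_, ?_, abs_lt.2 ⟨?_, ?_⟩⟩, fun z hz => ?_⟩
    · have := h0 1 z fun h => absurd h (by decide); simp [a, b, c] at this; linarith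
    · have := h0 0 z fun h => absurd h (by decide); simp [a, b, c] at this; linarith
    · have := h0 3 z fun h => absurd h (by decide); simp [a, b, c] at this; linarith
    · have := h0 2 z fun h => absurd h (by decide); simp [a, b, c] at this; linarith
    · have := h0 4 z fun _ => hz; simp [a, b, c] at this; linarith
  · push Not at hex
    obtain ⟨μ, hμ, hμ0, hμT, hμψ⟩ := exists_measure_of_forall_exists_le T ψ hex
    have hint : ∀ f : C(CB d, ℂ), Integrable (fun y : Y => f y.1.2 * c y.1.1) μ := fun f =>
      ((f.continuous.comp hπ).mul hc).integrable_of_hasCompactSupport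
        (HasCompactSupport.of_compactSpace _)
    have hann : ∀ f ∈ ballAlg d, ∫ y : Y, f y.1.2 * c y.1.1 ∂μ = 0 := by
      intro f hf
      apply Complex.ext
      · rw [← Complex.reCLM_apply, ← Complex.reCLM.integral_comp_comm (hint f)]
        exact hμT ⟨f, hf⟩
      · rw [← Complex.imCLM_apply, ← Complex.imCLM.integral_comp_comm (hint f)]
        have := hμT (Complex.I • ⟨f, hf⟩)
        rw [← neg_eq_zero, ← integral_neg] at this
        rw [Complex.zero_im, ← this]
        refine integral_congr_ae (.of_forall fun y => ?_)
        simp [T]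
    have hKπ : MeasurableSet ((fun y : Y => y.1.2) ⁻¹' K) := hπ.measurable hK.measurableSet
    have hzero := setIntegral_preimage_eq_zero μ hπ hc hann hK.measurableSet hKnull
    have hci : Integrable (fun y : Y => c y.1.1) μ := by simpa using hint 1
    have hzero' : ∫ y in (fun y : Y => y.1.2) ⁻¹' K, (c y.1.1).re ∂μ = 0 := by
      have := Complex.reCLM.integral_comp_comm hci.integrableOn
        (μ := μ.restrict ((fun y : Y => y.1.2) ⁻¹' K))
      rw [hzero] at this
      simpa using this
    have hle : ∀ y : Y, η + ((fun y : Y => y.1.2) ⁻¹' K).indicator (fun y => (c y.1.1).re) y ≤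
        ψ y := by
      rintro ⟨⟨i, z⟩, hz⟩
      change _ ≤ a i + b i * u z
      by_cases hzK : z ∈ K
      · rw [indicator_of_mem (show (⟨(i, z), hz⟩ : Y) ∈ (fun y : Y => y.1.2) ⁻¹' K from hzK)]
        fin_cases i <;> simp [a, b, c, huK z hzK]
      · rw [indicator_of_notMem (show (⟨(i, z), hz⟩ : Y) ∉ (fun y : Y => y.1.2) ⁻¹' K from hzK)]
        fin_cases i
        · simpa [a, b] using hu z
        · simp [a, b]
        · simp [a, b]
        · simp [a, b]
        · exact absurd (hz rfl) hzK
    have hre : Integrable (((fun y : Y => y.1.2) ⁻¹' K).indicator fun y => (c y.1.1).re) μ :=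
      hci.re.indicator hKπ
    have h1 := integral_mono ((integrable_const η).add hre)
      (ψ.continuous.integrable_of_hasCompactSupport (HasCompactSupport.of_compactSpace _)) hle
    rw [Pi.add_def, integral_add (integrable_const η) hre, integral_indicator hKπ, hzero',
      add_zero, integral_const, smul_eq_mul] at h1
    have h2 : 0 < μ.real univ := by
      rw [measureReal_def, ENNReal.toReal_pos_iff]
      exact ⟨(Measure.measure_univ_pos).2 hμ0, measure_lt_top _ _⟩
    have := mul_pos h2 hη
    linarith

lemma exists_peak {d : ℕ} {K U : Set (CB d)} (hK : IsCompact K) (hKnull : IsTotallyNull d K)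
    (hU : IsOpen U) (hKU : K ⊆ U) {η : ℝ} (hη : 0 < η) :
    ∃ q ∈ ballAlg d, (∀ z, ‖q z‖ ≤ 1 + η ∧ ‖1 - q z‖ ≤ 1 + η) ∧ (∀ z ∈ K, ‖1 - q z‖ ≤ η) ∧
      ∀ z ∉ U, ‖q z‖ ≤ η := by
  obtain ⟨u, hu0, hu1, hu⟩ := exists_continuous_zero_one_of_isClosed hU.isClosed_compl hK.isClosed
    (disjoint_compl_left_iff_subset.2 hKU)
  obtain ⟨q, hq, hq1, hq2⟩ := exists_peak_re_im hK hKnull u (fun z => (hu z).1) hu1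
    (half_pos hη)
  have hb : ∀ w : ℂ, ‖w‖ ≤ |w.re| + |w.im| := Complex.norm_le_abs_re_add_abs_im
  refine ⟨q, hq, fun z => ⟨?_, ?_⟩, fun z hz => ?_, fun z hz => ?_⟩ <;>
    obtain ⟨h1, h2, h3⟩ := hq1 z <;> refine (hb _).trans ?_
  · have : |(q z).re| ≤ 1 + η / 2 := abs_le.2 ⟨by linarith, by linarith [(hu z).2]⟩
    linarith
  · have : |(1 - q z).re| ≤ 1 + η / 2 := by
      rw [Complex.sub_re, Complex.one_re]
      exact abs_le.2 ⟨by linarith [(hu z).2], by linarith⟩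
    have : |(1 - q z).im| = |(q z).im| := by simp
    linarith
  · have : |(1 - q z).re| ≤ η / 2 := by
      rw [Complex.sub_re, Complex.one_re]
      exact abs_le.2 ⟨by linarith [(hu z).2], by linarith [hq2 z hz]⟩
    have : |(1 - q z).im| = |(q z).im| := by simp
    linarith
  · have h0 : u z = 0 := hu0 hz
    have : |(q z).re| ≤ η / 2 := abs_le.2 ⟨by linarith, by linarith⟩
    linarith

lemma exists_mem_norm_le_half {d : ℕ} {J : Set C(CB d, ℂ)} (hJ : IsClosedIdeal d J)
    {E : Set (CB d)} (hE : IsTotallyNull d E) (hclE : closure E ⊆ ZS d J ∪ E)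
    {z₀ : CB d} (hz₀ : z₀ ∉ E) {F : C(CB d, ℂ)} (hF : F ∈ J) {s ε : ℝ} (hs : 0 < s) (hε : 0 < ε)
    (hFE : ∀ z ∈ E, ‖F z‖ ≤ s) :
    ∃ G ∈ J, (∀ z ∈ E, ‖G z‖ ≤ s / 2) ∧ ‖F - G‖ ≤ 4 * s ∧ ‖F z₀ - G z₀‖ ≤ ε := by
  let K : Set (CB d) := {z | z ∈ E ∧ s / 4 ≤ ‖F z‖}
  have hKeq : K = closure E ∩ {z | s / 4 ≤ ‖F z‖} := by
    refine Subset.antisymm (fun z hz => ⟨subset_closure hz.1, hz.2⟩) fun z ⟨hz, hz2⟩ => ?_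
    rcases hclE hz with h | h
    · have : ‖F z‖ = 0 := by rw [h F hF, norm_zero]
      rw [mem_ofPred_eq, this] at hz2
      linarith
    · exact ⟨h, hz2⟩
  have hK : IsCompact K := by
    rw [hKeq]
    exact (isClosed_closure.inter (isClosed_le continuous_const F.continuous.norm)).isCompact
  have hKnull : IsTotallyNull d K :=
    ⟨fun z hz => hE.1 hz.1, fun μ hμ => measure_mono_null (fun z hz => hz.1) (hE.2 μ hμ)⟩
  let U : Set (CB d) := {z | ‖F z‖ < 2 * s} ∩ {z₀}ᶜ
  have hU : IsOpen U :=
    (isOpen_lt F.continuous.norm continuous_const).inter isOpen_compl_singleton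
  have hKU : K ⊆ U := fun z hz =>
    ⟨(hFE z hz.1).trans_lt (by linarith), fun h => hz₀ (h ▸ hz.1)⟩
  set η : ℝ := min 1 (min (s / 4) ε / (‖F‖ + 1))
  have hη0 : 0 < η := by positivity
  have hη1 : η ≤ 1 := min_le_left _ _
  have hηF : η * ‖F‖ ≤ min (s / 4) ε := by
    have h1 : η ≤ min (s / 4) ε / (‖F‖ + 1) := min_le_right _ _
    rw [le_div_iff₀ (by positivity)] at h1
    linarith
  have hηs : η * ‖F‖ ≤ s / 4 := hηF.trans (min_le_left _ _)
  have hηε : η * ‖F‖ ≤ ε := hηF.trans (min_le_right _ _)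
  obtain ⟨q, hq, hq1, hq2, hq3⟩ := exists_peak hK hKnull hU hKU hη0
  have hFn := F.norm_coe_le_norm
  refine ⟨F + (-1 : ℂ) • (q * F), hJ.add_mem _ hF _ (hJ.smul_mem _ _ (hJ.mul_mem _ hq _ hF)),
    fun z hz => ?_, ?_, ?_⟩
  · have : (F + (-1 : ℂ) • (q * F)) z = (1 - q z) * F z := by simp; ring
    rw [this, norm_mul]
    by_cases hzK : z ∈ K
    · have := mul_le_mul (hq2 z hzK) (hFn z) (norm_nonneg _) hη0.le
      linarith
    · have hlt : ‖F z‖ ≤ s / 4 := by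
        by_contra! h
        exact hzK ⟨hz, h.le⟩
      have := mul_le_mul (hq1 z).2 hlt (norm_nonneg _) (by positivity)
      nlinarith
  · rw [ContinuousMap.norm_le _ (by positivity)]
    intro z
    have : (F - (F + (-1 : ℂ) • (q * F))) z = q z * F z := by simp
    rw [this, norm_mul]
    by_cases hzF : ‖F z‖ < 2 * s ∧ z ≠ z₀
    · have := mul_le_mul (hq1 z).1 hzF.1.le (norm_nonneg _) (by positivity)
      nlinarith
    · have := mul_le_mul (hq3 z hzF) (hFn z) (norm_nonneg _) hη0.le
      linarith
  · have : F z₀ - (F + (-1 : ℂ) • (q * F)) z₀ = q z₀ * F z₀ := by simp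
    rw [this, norm_mul]
    exact (mul_le_mul (hq3 z₀ fun h => h.2 rfl) (hFn z₀) (norm_nonneg _) hη0.le).trans hηε

lemma exists_mem_eq_zero_on {d : ℕ} {J : Set C(CB d, ℂ)} (hJ : IsClosedIdeal d J)
    {E : Set (CB d)} (hE : IsTotallyNull d E) (hclE : closure E ⊆ ZS d J ∪ E)
    {z₀ : CB d} (hz₀ : z₀ ∉ E) {f : C(CB d, ℂ)} (hf : f ∈ J) (hfz₀ : f z₀ ≠ 0) :
    ∃ F ∈ J, (∀ z ∈ E, F z = 0) ∧ F z₀ ≠ 0 := by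
  set s : ℝ := ‖f‖ + 1
  have hs : 0 < s := by positivity
  set ε : ℝ := ‖f z₀‖ / 4
  have hε : 0 < ε := by positivity
  let P : ℕ → C(CB d, ℂ) → Prop := fun n F => F ∈ J ∧ ∀ z ∈ E, ‖F z‖ ≤ s * (1 / 2) ^ n
  have hstep : ∀ n F, P n F → ∃ G, P (n + 1) G ∧ ‖F - G‖ ≤ 4 * s * (1 / 2) ^ n ∧
      ‖F z₀ - G z₀‖ ≤ ε * (1 / 2) ^ n := by
    intro n F hF
    obtain ⟨G, hG, h1, h2, h3⟩ := exists_mem_norm_le_half hJ hE hclE hz₀ hF.1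
      (show 0 < s * (1 / 2) ^ n by positivity) (show 0 < ε * (1 / 2) ^ n by positivity) hF.2
    refine ⟨G, ⟨hG, fun z hz => (h1 z hz).trans_eq ?_⟩, h2.trans_eq ?_, h3⟩ <;> ring
  choose! step hnext using hstep
  let u : ℕ → C(CB d, ℂ) := fun n => Nat.rec f (fun n F => step n F) n
  have hu : ∀ n, P n (u n) := fun n => by
    induction n with
    | zero =>
      refine ⟨hf, fun z _ => (f.norm_coe_le_norm z).trans ?_⟩
      simp [s]
    | succ n ih => exact (hnext n _ ih).1
  have hdist : ∀ n, dist (u n) (u (n + 1)) ≤ 4 * s * (1 / 2) ^ n := fun n => by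
    rw [dist_eq_norm]; exact (hnext n _ (hu n)).2.1
  have hdist₀ : ∀ n, dist (u n z₀) (u (n + 1) z₀) ≤ ε * (1 / 2) ^ n := fun n => by
    rw [dist_eq_norm]; exact (hnext n _ (hu n)).2.2
  obtain ⟨F, hF⟩ := cauchySeq_tendsto_of_complete
    (cauchySeq_of_le_geometric (1 / 2) (4 * s) one_half_lt_one hdist)
  have hev : ∀ z, Tendsto (fun n => u n z) atTop (𝓝 (F z)) := fun z =>
    ((continuous_eval_const (F := C(CB d, ℂ)) z).tendsto _).comp hF
  refine ⟨F, hJ.closed.mem_of_tendsto hF (.of_forall fun n => (hu n).1), fun z hz => ?_, ?_⟩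
  · have hlim : Tendsto (fun n : ℕ => s * (1 / 2 : ℝ) ^ n) atTop (𝓝 0) := by
      simpa using (tendsto_pow_atTop_nhds_zero_of_lt_one (by norm_num) one_half_lt_one).const_mul s
    exact tendsto_nhds_unique (hev z) (squeeze_zero_norm (fun n => (hu n).2 z hz) hlim)
  · intro h0
    have h1 := dist_le_of_le_geometric_of_tendsto₀ (1 / 2) ε one_half_lt_one hdist₀ (hev z₀)
    rw [h0, dist_zero_right] at h1
    have h2 : ‖f z₀‖ ≤ ε / (1 - 1 / 2) := h1
    have h3 : 0 < ‖f z₀‖ := norm_pos_iff.2 hfz₀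
    have h4 : ε / (1 - 1 / 2) = ‖f z₀‖ / 2 := by simp only [ε]; ring
    linarith

/-- for a closed ideal `J` and a totally null Borel set `E ⊆ 𝕊_d` with
`closure E ⊆ Z(J) ∪ E`, the ideal `J' = J ∩ I(E)` has zero set `Z(J) ∪ E`. -/
theorem stmt7 (d : ℕ) (hd : 1 ≤ d) (J : Set C(CB d, ℂ)) (hJ : IsClosedIdeal d J)
    (E : Set (CB d)) (hEmeas : MeasurableSet E) (hTN : IsTotallyNull d E)
    (hclE : closure E ⊆ ZS d J ∪ E) :
    ZS d (J ∩ IX d E) = ZS d J ∪ E := by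
  refine Subset.antisymm (fun z hz => ?_) ?_
  · by_contra hcon
    rw [mem_union, not_or] at hcon
    obtain ⟨hzJ, hzE⟩ := hcon
    simp only [ZS, mem_ofPred_eq, not_forall] at hzJ
    obtain ⟨f, hf, hfz⟩ := hzJ
    obtain ⟨F, hF, hFE, hFz⟩ := exists_mem_eq_zero_on hJ hTN hclE hzE hf hfz
    exact hFz (hz F ⟨hF, hJ.subset hF, hFE⟩)
  · rintro z (hz | hz) φ hφ
    · exact hz φ hφ.1
    · exact hφ.2.2 z hz

end
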